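/- Suppose 𝐅 ∈ Λ'_{q,l} with q>0. Then for all sufficiently large t (namely whenever t²q > 2), the sesquilinear form of the scaled symbol F_t is bounded on the Fock space: |𝐭_{F_t}(u,v)| = |⟨W_t𝐅, u v̄⟩| ≤ C ‖u‖_𝓑 ‖v‖_𝓑 for all u,v ∈ 𝓑. -/

import Mathlib

open MeasureTheory Filter Complex Metric

noncomputable section

/-- The Gaussian weight `ω(z) = π⁻¹ exp (-|z|²)`. -/
def omegaW (z : ℂ) : ℝ := Real.pi⁻¹ * Real.exp (-‖z‖ ^ 2)

/-- Membership in the weighted space `Λ_{q,l}`: `C^l`-smooth functions whose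
derivatives up to order `l` are `o(exp (q|z|²))` at infinity. -/
def MemLambda (q : ℝ) (l : ℕ) (ψ : ℂ → ℂ) : Prop :=
  ContDiff ℝ (l : ℕ∞) ψ ∧
    ∀ n : ℕ, n ≤ l →
      Tendsto (fun z : ℂ => ‖iteratedFDeriv ℝ n ψ z‖ * Real.exp (-q * ‖z‖ ^ 2))
        (cocompact ℂ) (nhds 0)

/-- The norm of `Λ_{q,l}`. -/
def lambdaNorm (q : ℝ) (l : ℕ) (ψ : ℂ → ℂ) : ℝ :=
  sSup {r : ℝ | ∃ n ≤ l, ∃ z : ℂ, r = ‖iteratedFDeriv ℝ n ψ z‖ * Real.exp (-q * ‖z‖ ^ 2)}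

/-- Distributions on `ℂ`, encoded by their pairing against test functions
(with respect to Lebesgue measure). -/
abbrev Dst : Type := (ℂ → ℂ) → ℂ

/-- Membership in the dual space `Λ'_{q,l}`. -/
def MemLambdaDual (q : ℝ) (l : ℕ) (T : Dst) : Prop :=
  (∀ ψ φ, MemLambda q l ψ → MemLambda q l φ → T (ψ + φ) = T ψ + T φ) ∧
  (∀ (c : ℂ) (ψ), MemLambda q l ψ → T (c • ψ) = c * T ψ) ∧
  (∃ C : ℝ, ∀ ψ, MemLambda q l ψ → ‖T ψ‖ ≤ C * lambdaNorm q l ψ)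

/-- The dual norm on `Λ'_{q,l}`. -/
def lambdaDualNorm (q : ℝ) (l : ℕ) (T : Dst) : ℝ :=
  sInf {C : ℝ | 0 ≤ C ∧ ∀ ψ, MemLambda q l ψ → ‖T ψ‖ ≤ C * lambdaNorm q l ψ}

/-- `∂̄ = (∂/∂x + i ∂/∂y)/2` of a function. -/
def dbarFun (ψ : ℂ → ℂ) : ℂ → ℂ := fun z =>
  (fderiv ℝ ψ z 1 + Complex.I * fderiv ℝ ψ z Complex.I) / 2

/-- Membership in `𝔇_q`: smooth functions all of whose derivatives are
`o(exp (q|z|²))`. -/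
def MemDq (q : ℝ) (ψ : ℂ → ℂ) : Prop :=
  ContDiff ℝ (⊤ : ℕ∞) ψ ∧
    ∀ n : ℕ,
      Tendsto (fun z : ℂ => ‖iteratedFDeriv ℝ n ψ z‖ * Real.exp (-q * ‖z‖ ^ 2))
        (cocompact ℂ) (nhds 0)

/-- Membership in the dual space `𝔇'_q`; every such distribution has finite
order, i.e. is bounded by some `Λ_{q,l}`-norm. -/
def MemDqDual (q : ℝ) (T : Dst) : Prop :=
  (∀ ψ φ, MemDq q ψ → MemDq q φ → T (ψ + φ) = T ψ + T φ) ∧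
  (∀ (c : ℂ) (ψ), MemDq q ψ → T (c • ψ) = c * T ψ) ∧
  (∃ (l : ℕ) (C : ℝ), ∀ ψ, MemDq q ψ → ‖T ψ‖ ≤ C * lambdaNorm q l ψ)

/-- Membership in the Fock space `𝓑`: entire and square integrable against `ω dλ`. -/
def MemFock (u : ℂ → ℂ) : Prop :=
  Differentiable ℂ u ∧ Integrable (fun z : ℂ => ‖u z‖ ^ 2 * omegaW z)

/-- The Fock norm. -/
def fockNorm (u : ℂ → ℂ) : ℝ := Real.sqrt (∫ z : ℂ, ‖u z‖ ^ 2 * omegaW z)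

/-- The Fock (weighted `L²`) inner product `(u,v) = ∫ u v̄ ω dλ`. -/
def fockInner (u v : ℂ → ℂ) : ℂ := ∫ z : ℂ, u z * (starRingEnd ℂ) (v z) * (omegaW z : ℂ)

/-- The reproducing kernel `κ_z(w) = exp (w z̄)`. -/
def repKer (z : ℂ) : ℂ → ℂ := fun w => Complex.exp (w * (starRingEnd ℂ) z)

/-- The Toeplitz sesquilinear form `𝐭_F(u,v) = ⟨ωF, u v̄⟩`, expressed through the
distribution `T = 𝐅 = ωF`. -/
def toeplitzForm (T : Dst) (u v : ℂ → ℂ) : ℂ := T fun z => u z * (starRingEnd ℂ) (v z)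

/-- An infinite matrix has rank at most `N` iff every finite submatrix does. -/
def InfRankLE (A : ℕ → ℕ → ℂ) (N : ℕ) : Prop :=
  ∀ (m : ℕ) (r c : Fin m → ℕ), (Matrix.of fun i j : Fin m => A (r i) (c j)).rank ≤ N

/-- The matrix `𝔓(F)` with entries `𝐭_F(z^k, z^{k'})`. -/
def matP (T : Dst) : ℕ → ℕ → ℂ :=
  fun k k' => toeplitzForm T (fun z => z ^ k) (fun z => z ^ k')

/-- The matrix `𝔎(F)` attached to a sequence of points, with entries
`𝐭_F(κ_{z_k}, κ_{z_{k'}})`. -/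
def matK (T : Dst) (zs : ℕ → ℂ) : ℕ → ℕ → ℂ :=
  fun k k' => toeplitzForm T (repKer (zs k)) (repKer (zs k'))

/-- The scaling `S_t ψ (z) = t ψ(tz)`. -/
def scaleS (t : ℝ) (ψ : ℂ → ℂ) : ℂ → ℂ := fun z => (t : ℂ) * ψ ((t : ℂ) * z)

/-- The scaling `W_t` on distributions, `⟨W_t 𝐅, ψ⟩ = ⟨𝐅, S_{t⁻¹} ψ⟩`. -/
def scaleW (t : ℝ) (T : Dst) : Dst := fun ψ => T (scaleS t⁻¹ ψ)

open Set in
theorem two_pi_mul_enorm_le_lintegral_circle {f : ℂ → ℂ} (hf : Differentiable ℂ f) (r : ℝ) :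
    ∫⁻ _ in Ioo (-Real.pi) Real.pi, ‖f 0‖ₑ ≤
      ∫⁻ θ in Ioo (-Real.pi) Real.pi, ‖f (circleMap 0 r θ)‖ₑ := by
  have hmean : Real.circleAverage f 0 r = f 0 := hf.diffContOnCl.circleAverage
  rw [Real.circleAverage_eq_integral_add (-Real.pi),
    intervalIntegral.integral_comp_add_right (fun θ ↦ f (circleMap 0 r θ)), zero_add,
    show 2 * Real.pi + -Real.pi = Real.pi by ring,
    intervalIntegral.integral_of_le (by linarith [Real.pi_pos]),
    integral_Ioc_eq_integral_Ioo] at hmean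
  rw [lintegral_const, Measure.restrict_apply_univ, Real.volume_Ioo,
    show Real.pi - -Real.pi = 2 * Real.pi by ring]
  calc ‖f 0‖ₑ * ENNReal.ofReal (2 * Real.pi)
      = ‖(2 * Real.pi) • f 0‖ₑ := by
        rw [enorm_smul, mul_comm, Real.enorm_of_nonneg (by positivity)]
    _ = ‖∫ θ in Ioo (-Real.pi) Real.pi, f (circleMap 0 r θ)‖ₑ := by
        rw [← hmean, smul_inv_smul₀ (by positivity)]
    _ ≤ _ := enorm_integral_le_lintegral_enorm _

open Set in
/-- Mean value inequality for entire functions against a radial weight. -/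
theorem lintegral_radial_mul_enorm_zero_le {f : ℂ → ℂ} (hf : Differentiable ℂ f)
    {ρ : ℝ → ENNReal} (hρ : Measurable ρ) :
    ∫⁻ z : ℂ, ρ ‖z‖ * ‖f 0‖ₑ ≤ ∫⁻ z : ℂ, ρ ‖z‖ * ‖f z‖ₑ := by
  have hcont := hf.continuous
  have hpolar (g : ℂ → ENNReal) (hg : Measurable g) : ∫⁻ z : ℂ, ρ ‖z‖ * g z =
      ∫⁻ r in Ioi (0 : ℝ), ENNReal.ofReal r * ρ |r| *
        ∫⁻ θ in Ioo (-Real.pi) Real.pi, g (circleMap 0 r θ) := by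
    have hcircle : Measurable fun p : ℝ × ℝ => circleMap 0 p.1 p.2 := by
      unfold circleMap
      fun_prop
    rw [← Complex.lintegral_comp_polarCoord_symm, polarCoord_target,
      Measure.volume_eq_prod, ← Measure.prod_restrict]
    have hsymm (p : ℝ × ℝ) : Complex.polarCoord.symm p = circleMap 0 p.1 p.2 := by
      simp [circleMap, Complex.exp_mul_I]
    simp only [hsymm, smul_eq_mul, norm_circleMap_zero]
    rw [lintegral_prod _ (by fun_prop)]
    refine lintegral_congr fun r => ?_
    rw [← lintegral_const_mul _ (by fun_prop)]
    simp only [mul_assoc]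
  rw [hpolar _ measurable_const, hpolar (fun z => ‖f z‖ₑ) (by fun_prop)]
  refine lintegral_mono fun r => mul_le_mul_right ?_ _
  exact two_pi_mul_enorm_le_lintegral_circle hf r

theorem integral_omegaW : ∫ z : ℂ, omegaW z = 1 := by
  have h := GaussianFourier.integral_rexp_neg_mul_sq_norm (V := ℂ) one_pos
  simp only [neg_mul, one_mul, Complex.finrank_real_complex, div_one] at h
  unfold omegaW
  rw [integral_const_mul, h]
  simp [Real.pi_ne_zero]

theorem integrable_omegaW : Integrable omegaW :=
  Integrable.of_integral_ne_zero (by simp [integral_omegaW])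

theorem omegaW_nonneg (z : ℂ) : 0 ≤ omegaW z := by
  unfold omegaW
  positivity

theorem norm_zero_le_integral_omegaW {f : ℂ → ℂ} (hf : Differentiable ℂ f)
    (hint : Integrable fun z => ‖f z‖ * omegaW z) :
    ‖f 0‖ ≤ ∫ z : ℂ, ‖f z‖ * omegaW z := by
  have hρ : Measurable fun r : ℝ => ENNReal.ofReal (Real.pi⁻¹ * Real.exp (-r ^ 2)) := by
    fun_prop
  have h := lintegral_radial_mul_enorm_zero_le hf hρ
  have hpt (z : ℂ) (c : ℂ) : ENNReal.ofReal (Real.pi⁻¹ * Real.exp (-‖z‖ ^ 2)) * ‖c‖ₑ =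
      ENNReal.ofReal (‖c‖ * omegaW z) := by
    rw [ENNReal.ofReal_mul (norm_nonneg c), ofReal_norm, mul_comm, omegaW]
  simp only [hpt] at h
  rw [← ofReal_integral_eq_lintegral_ofReal (integrable_omegaW.const_mul _)
      (ae_of_all _ fun z => mul_nonneg (norm_nonneg _) (omegaW_nonneg z)),
    ← ofReal_integral_eq_lintegral_ofReal hint
      (ae_of_all _ fun z => mul_nonneg (norm_nonneg _) (omegaW_nonneg z)),
    integral_const_mul, integral_omegaW, mul_one] at h
  exact (ENNReal.ofReal_le_ofReal_iff (integral_nonneg fun z =>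
    mul_nonneg (norm_nonneg _) (omegaW_nonneg z))).1 h

theorem fockNorm_nonneg (u : ℂ → ℂ) : 0 ≤ fockNorm u := Real.sqrt_nonneg _

/-- The pointwise estimate coming from the reproducing kernel of the Fock space. -/
theorem MemFock.norm_le {u : ℂ → ℂ} (hu : MemFock u) (w : ℂ) :
    ‖u w‖ ≤ fockNorm u * Real.exp (‖w‖ ^ 2 / 2) := by
  obtain ⟨hd, hi⟩ := hu
  set f : ℂ → ℂ := fun z => u (z + w) ^ 2 * Complex.exp (-2 * (z * (starRingEnd ℂ) w)) with hf
  have hfd : Differentiable ℂ f := by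
    have h1 : Differentiable ℂ fun z => u (z + w) := hd.comp (by fun_prop)
    fun_prop
  have hpt (z : ℂ) : ‖f z‖ * omegaW z =
      Real.exp (‖w‖ ^ 2) * (‖u (z + w)‖ ^ 2 * omegaW (z + w)) := by
    have hexp : Real.exp (-2 * (z * (starRingEnd ℂ) w).re) * Real.exp (-‖z‖ ^ 2) =
        Real.exp (‖w‖ ^ 2) * Real.exp (-‖z + w‖ ^ 2) := by
      rw [← Real.exp_add, ← Real.exp_add]
      congr 1
      simp only [Complex.sq_norm, Complex.normSq_add]
      ring
    have hre : (-2 * (z * (starRingEnd ℂ) w)).re = -2 * (z * (starRingEnd ℂ) w).re := by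
      simp
    rw [hf, norm_mul, norm_pow, Complex.norm_exp, hre, omegaW, omegaW]
    linear_combination (‖u (z + w)‖ ^ 2 * Real.pi⁻¹) * hexp
  have hint : Integrable fun z => ‖f z‖ * omegaW z := by
    simp only [hpt]
    exact (hi.comp_add_right w).const_mul _
  have hmean := norm_zero_le_integral_omegaW hfd hint
  simp only [hpt] at hmean
  rw [integral_const_mul, integral_add_right_eq_self (fun z => ‖u z‖ ^ 2 * omegaW z)] at hmean
  have hnn : 0 ≤ ∫ z : ℂ, ‖u z‖ ^ 2 * omegaW z :=
    integral_nonneg fun z => mul_nonneg (by positivity) (omegaW_nonneg z)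
  refine le_of_sq_le_sq ?_ (mul_nonneg (fockNorm_nonneg u) (Real.exp_nonneg _))
  have hsq : Real.exp (‖w‖ ^ 2 / 2) ^ 2 = Real.exp (‖w‖ ^ 2) := by
    rw [← Real.exp_nat_mul]
    congr 1
    push_cast
    ring
  rw [mul_pow, hsq, fockNorm, Real.sq_sqrt hnn, mul_comm]
  simpa [hf] using hmean

/-- Cauchy estimates for the real Fréchet derivatives of an entire function of
Gaussian growth. -/
theorem norm_iteratedFDeriv_le_of_gaussian_growth {f : ℂ → ℂ} (hf : Differentiable ℂ f)
    {N b : ℝ} (hN : 0 ≤ N) (hb : 0 ≤ b)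
    (hfb : ∀ z, ‖f z‖ ≤ N * Real.exp (b * ‖z‖ ^ 2 / 2)) (n : ℕ) (z : ℂ) :
    ‖iteratedFDeriv ℝ n f z‖ ≤ n.factorial * (N * Real.exp (b * (‖z‖ ^ 2 + 1))) := by
  have hc : ContDiffAt ℂ n f z := hf.contDiff.contDiffAt
  rw [← hc.restrictScalars_iteratedFDeriv (𝕜 := ℝ), Function.comp_apply,
    ContinuousMultilinearMap.norm_restrictScalars, norm_iteratedFDeriv_eq_norm_iteratedDeriv]
  refine (Complex.norm_iteratedDeriv_le_of_forall_mem_sphere_norm_le n one_pos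
    hf.diffContOnCl (C := N * Real.exp (b * (‖z‖ ^ 2 + 1))) fun w hw => ?_).trans_eq (by simp)
  refine (hfb w).trans ?_
  have hw' : ‖w‖ ≤ ‖z‖ + 1 := by
    rw [mem_sphere_iff_norm] at hw
    calc ‖w‖ = ‖z + (w - z)‖ := by rw [add_sub_cancel]
      _ ≤ ‖z‖ + 1 := hw ▸ norm_add_le _ _
  gcongr
  have : ‖w‖ ^ 2 ≤ 2 * (‖z‖ ^ 2 + 1) := by
    nlinarith [norm_nonneg w, norm_nonneg z, sq_nonneg (‖z‖ - 1)]
  nlinarith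

theorem norm_iteratedFDeriv_mul_conj_le {f g : ℂ → ℂ} (hf : Differentiable ℂ f)
    (hg : Differentiable ℂ g) {N M b : ℝ} (hN : 0 ≤ N) (hM : 0 ≤ M) (hb : 0 ≤ b)
    (hfb : ∀ z, ‖f z‖ ≤ N * Real.exp (b * ‖z‖ ^ 2 / 2))
    (hgb : ∀ z, ‖g z‖ ≤ M * Real.exp (b * ‖z‖ ^ 2 / 2)) (n : ℕ) (z : ℂ) :
    ‖iteratedFDeriv ℝ n (fun z => f z * (starRingEnd ℂ) (g z)) z‖ ≤
      (n + 1).factorial * (N * M) * Real.exp (2 * b * (‖z‖ ^ 2 + 1)) := by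
  have hfc : ContDiff ℝ n f := hf.contDiff.restrict_scalars ℝ
  have hgc : ContDiff ℝ n fun z => (starRingEnd ℂ) (g z) :=
    Complex.conjCLE.contDiff.comp (hg.contDiff.restrict_scalars ℝ)
  have hconj (k : ℕ) : ‖iteratedFDeriv ℝ k (fun z => (starRingEnd ℂ) (g z)) z‖ =
      ‖iteratedFDeriv ℝ k g z‖ :=
    Complex.conjLIE.norm_iteratedFDeriv_comp_left g z k
  have hE : Real.exp (2 * b * (‖z‖ ^ 2 + 1)) =
      Real.exp (b * (‖z‖ ^ 2 + 1)) * Real.exp (b * (‖z‖ ^ 2 + 1)) := by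
    rw [← Real.exp_add]
    congr 1
    ring
  calc _ ≤ ∑ i ∈ Finset.range (n + 1), (n.choose i : ℝ) * ‖iteratedFDeriv ℝ i f z‖ *
          ‖iteratedFDeriv ℝ (n - i) (fun z => (starRingEnd ℂ) (g z)) z‖ :=
        norm_iteratedFDeriv_mul_le hfc hgc z le_rfl
    _ ≤ ∑ i ∈ Finset.range (n + 1), (n.choose i : ℝ) *
          (i.factorial * (N * Real.exp (b * (‖z‖ ^ 2 + 1)))) *
          ((n - i).factorial * (M * Real.exp (b * (‖z‖ ^ 2 + 1)))) := by
        simp only [hconj]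
        gcongr
        · exact norm_iteratedFDeriv_le_of_gaussian_growth hf hN hb hfb _ z
        · exact norm_iteratedFDeriv_le_of_gaussian_growth hg hM hb hgb _ z
    _ = ∑ i ∈ Finset.range (n + 1), (n.factorial : ℝ) * (N * M) *
          Real.exp (2 * b * (‖z‖ ^ 2 + 1)) := by
        refine Finset.sum_congr rfl fun i hi => ?_
        have hfac : (n.choose i : ℝ) * i.factorial * (n - i).factorial = n.factorial := by
          exact_mod_cast Nat.choose_mul_factorial_mul_factorial
            (Nat.lt_succ_iff.1 (Finset.mem_range.1 hi))
        rw [hE, ← hfac]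
        ring
    _ = _ := by
        rw [Finset.sum_const, Finset.card_range, nsmul_eq_mul, Nat.factorial_succ]
        push_cast
        ring

theorem memLambda_and_lambdaNorm_le {q a K : ℝ} {l : ℕ} {ψ : ℂ → ℂ} (haq : a < q)
    (hψ : ContDiff ℝ (l : ℕ∞) ψ) (hK : 0 ≤ K)
    (hbound : ∀ n ≤ l, ∀ z, ‖iteratedFDeriv ℝ n ψ z‖ ≤ K * Real.exp (a * ‖z‖ ^ 2)) :
    MemLambda q l ψ ∧ lambdaNorm q l ψ ≤ K := by
  have hle (n : ℕ) (hn : n ≤ l) (z : ℂ) :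
      ‖iteratedFDeriv ℝ n ψ z‖ * Real.exp (-q * ‖z‖ ^ 2) ≤
        K * Real.exp (-((q - a) * ‖z‖ ^ 2)) := by
    calc _ ≤ K * Real.exp (a * ‖z‖ ^ 2) * Real.exp (-q * ‖z‖ ^ 2) := by
          gcongr
          exact hbound n hn z
      _ = _ := by
          rw [mul_assoc, ← Real.exp_add]
          congr 2
          ring
  refine ⟨⟨hψ, fun n hn => ?_⟩, ?_⟩
  · refine squeeze_zero (fun z => by positivity) (hle n hn) ?_
    rw [← mul_zero K]
    refine Tendsto.const_mul K (Real.tendsto_exp_neg_atTop_nhds_zero.comp ?_)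
    exact Tendsto.const_mul_atTop (sub_pos.2 haq)
      ((tendsto_pow_atTop two_ne_zero).comp tendsto_norm_cocompact_atTop)
  · refine Real.sSup_le ?_ hK
    rintro r ⟨n, hn, z, rfl⟩
    refine (hle n hn z).trans (mul_le_of_le_one_right hK (Real.exp_le_one_iff.2 ?_))
    have := mul_nonneg (sub_pos.2 haq).le (sq_nonneg ‖z‖)
    linarith

theorem lambdaNorm_nonneg (q : ℝ) (l : ℕ) (ψ : ℂ → ℂ) : 0 ≤ lambdaNorm q l ψ := by
  refine Real.sSup_nonneg ?_
  rintro r ⟨n, -, z, rfl⟩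
  positivity

theorem MemFock.norm_comp_mul_le {u : ℂ → ℂ} (hu : MemFock u) (s : ℝ) (z : ℂ) :
    ‖u (s * z)‖ ≤ fockNorm u * Real.exp (s ^ 2 * ‖z‖ ^ 2 / 2) := by
  refine (hu.norm_le _).trans_eq ?_
  rw [norm_mul, Complex.norm_real, mul_pow, Real.norm_eq_abs, sq_abs]

/-- **Boundedness of the scaled form.** If `𝐅 ∈ Λ'_{q,l}` with `q > 0` then for all
sufficiently large `t` (namely whenever `t²q > 2`) the sesquilinear form of the
scaled symbol, `𝐭_{F_t}(u,v) = ⟨W_t𝐅, u v̄⟩`, is bounded on the Fock space. -/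
theorem scaled_toeplitz_form_bounded
    (q : ℝ) (hq : 0 < q) (l : ℕ) (T : Dst) (hT : MemLambdaDual q l T) :
    ∀ t : ℝ, 0 < t → 2 < t ^ 2 * q →
      ∃ C : ℝ, ∀ u v : ℂ → ℂ, MemFock u → MemFock v →
        ‖scaleW t T (fun z => u z * (starRingEnd ℂ) (v z))‖ ≤
          C * fockNorm u * fockNorm v := by
  intro t ht htq
  obtain ⟨-, -, C, hC⟩ := hT
  set s : ℝ := t⁻¹ with hs
  have hs0 : 0 < s := inv_pos.2 ht
  have hsq : 2 * s ^ 2 < q := by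
    rw [hs, inv_pow, ← div_eq_mul_inv, div_lt_iff₀ (by positivity)]
    linarith
  set M : ℝ := s * ((l + 1).factorial * Real.exp (2 * s ^ 2)) with hM
  refine ⟨|C| * M, fun u v hu hv => ?_⟩
  set g : ℂ → ℂ := fun z => u (s * z) * (starRingEnd ℂ) (v (s * z)) with hg
  have hNu := fockNorm_nonneg u
  have hNv := fockNorm_nonneg v
  have hud : Differentiable ℂ fun z : ℂ => u (s * z) := hu.1.comp (by fun_prop)
  have hvd : Differentiable ℂ fun z : ℂ => v (s * z) := hv.1.comp (by fun_prop)
  have hgc (n : WithTop ℕ∞) : ContDiff ℝ n g :=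
    (hud.contDiff.restrict_scalars ℝ).mul
      (Complex.conjCLE.contDiff.comp (hvd.contDiff.restrict_scalars ℝ))
  have hψ : scaleS s (fun z => u z * (starRingEnd ℂ) (v z)) = s • g := by
    ext z
    simp [scaleS, hg]
  have hbound : ∀ n ≤ l, ∀ z, ‖iteratedFDeriv ℝ n (s • g) z‖ ≤
      M * (fockNorm u * fockNorm v) * Real.exp (2 * s ^ 2 * ‖z‖ ^ 2) := by
    intro n hn z
    rw [iteratedFDeriv_const_smul_apply (hgc n).contDiffAt, norm_smul, Real.norm_of_nonneg hs0.le]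
    calc _ ≤ s * ((n + 1).factorial * (fockNorm u * fockNorm v) *
            Real.exp (2 * s ^ 2 * (‖z‖ ^ 2 + 1))) := by
          gcongr
          exact norm_iteratedFDeriv_mul_conj_le hud hvd hNu hNv (sq_nonneg s)
            (hu.norm_comp_mul_le s) (hv.norm_comp_mul_le s) n z
      _ ≤ s * ((l + 1).factorial * (fockNorm u * fockNorm v) *
            Real.exp (2 * s ^ 2 * (‖z‖ ^ 2 + 1))) := by gcongr
      _ = _ := by
          rw [mul_add, mul_one, Real.exp_add, hM]
          ring
  obtain ⟨hmem, hnorm⟩ := memLambda_and_lambdaNorm_le (ψ := s • g) hsq ((hgc _).const_smul s)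
    (by positivity) hbound
  rw [scaleW, hψ]
  calc ‖T (s • g)‖ ≤ C * lambdaNorm q l (s • g) := hC _ hmem
    _ ≤ |C| * lambdaNorm q l (s • g) := by
        gcongr
        · exact lambdaNorm_nonneg q l _
        · exact le_abs_self C
    _ ≤ |C| * (M * (fockNorm u * fockNorm v)) := by gcongr
    _ = _ := by ring
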